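/- arXiv:2503.03728 — 2 statements merged into one kernel-verified Lean document; each statement's English description precedes it below -/
import Mathlib

section
/- Let I ⊂ R = k[x,y,z] be the radical ideal of a set X of n distinct points of P² in tight generic n-position, and write n = C(s+1,2) + h with 0 ≤ h ≤ s/2, where s = indeg(I) ≥ 3. Then I has maximal analytic spread, i.e., ℓ(I) = 3. -/
open Matrix MvPolynomial

noncomputable section

def idealHeight {A : Type*} [CommRing A] (I : Ideal A) : ℕ∞ :=
  ⨅ (P : PrimeSpectrum A) (_ : I ≤ P.asIdeal), Order.height P

def minorsIdeal {A : Type*} [CommRing A] {p q : ℕ} (t : ℕ)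
    (M : Matrix (Fin p) (Fin q) A) : Ideal A :=
  Ideal.span { x | ∃ (r : Fin t → Fin p) (c : Fin t → Fin q),
    Function.Injective r ∧ Function.Injective c ∧ x = (M.submatrix r c).det }

/-- Condition `G_s` of Artin–Nagata: for every prime `P ⊇ L` with `ht P ≤ s − 1`,
the localization `L_P` can be generated by at most `ht P` elements. -/
def CondG {A : Type*} [CommRing A] (L : Ideal A) (s : ℕ) : Prop :=
  ∀ P : Ideal A, P.IsPrime → L ≤ P → idealHeight P + 1 ≤ (s : ℕ∞) →
    ∃ c : ℕ, (c : ℕ∞) ≤ idealHeight P ∧ ∃ g : Fin c → A, (∀ i, g i ∈ L) ∧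
      ∀ x ∈ L, ∃ u ∉ P, u * x ∈ Ideal.span (Set.range g)

/-- The skew-symmetric matrix of signed `m × m` minors (obtained by omitting two columns)
of an `m × (m+2)` matrix; this is the middle differential of the Buchsbaum–Rim complex. -/
def bbrim {A : Type*} [CommRing A] {m : ℕ} (ψ : Matrix (Fin m) (Fin (m + 2)) A) :
    Matrix (Fin (m + 2)) (Fin (m + 2)) A :=
  Matrix.of fun i j =>
    if h : (i : ℕ) < (j : ℕ) then
      (-1) ^ ((i : ℕ) + (j : ℕ)) *
        (ψ.submatrix id (fun q => j.succAbove
          ((⟨(i : ℕ), by have := j.isLt; omega⟩ : Fin (m + 1)).succAbove q))).det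
    else if h' : (j : ℕ) < (i : ℕ) then
      (-1) ^ ((i : ℕ) + (j : ℕ) + 1) *
        (ψ.submatrix id (fun q => i.succAbove
          ((⟨(j : ℕ), by have := i.isLt; omega⟩ : Fin (m + 1)).succAbove q))).det
    else 0

def rowMap {A : Type*} [CommRing A] {ι : Type*} [Fintype ι] (g : ι → A) :
    (ι → A) →ₗ[A] A :=
  ∑ i, g i • LinearMap.proj i

/-- Data of a (necessarily minimal) graded free resolution
`0 → ⊕_j R(−a_j) → ⊕_i R(−b_i) → I → 0` of an ideal of a polynomial ring. -/
def HasResolutionData {A : Type*} [CommRing A] {σ : Type*} (I : Ideal (MvPolynomial σ A))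
    {N M : ℕ} (b : Fin N → ℕ) (a : Fin M → ℕ) : Prop :=
  ∃ (g : Fin N → MvPolynomial σ A) (φ : Matrix (Fin N) (Fin M) (MvPolynomial σ A)),
    (∀ i, (g i).IsHomogeneous (b i)) ∧ Ideal.span (Set.range g) = I ∧
    (∀ i j, (φ i j).IsHomogeneous (a j - b i) ∧ (a j ≤ b i → φ i j = 0)) ∧
    Function.Injective φ.mulVecLin ∧
    LinearMap.range φ.mulVecLin = LinearMap.ker (rowMap g)

/-- The Castelnuovo–Mumford regularity of a codimension-two perfect ideal, read off from
its minimal graded free resolution `0 → ⊕_j R(−a_j) → ⊕_i R(−b_i) → I → 0` as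
`max(max_i b_i, max_j a_j − 1)`. -/
def HasRegularity {A : Type*} [CommRing A] {σ : Type*} (I : Ideal (MvPolynomial σ A))
    (r : ℕ) : Prop :=
  ∃ (N M : ℕ) (b : Fin N → ℕ) (a : Fin M → ℕ), HasResolutionData I b a ∧
    (Finset.univ.sup b) ⊔ ((Finset.univ.sup a) - 1) = r

def IsCohenMacaulayRing (A : Type*) [CommRing A] : Prop :=
  ∀ P : Ideal A, P.IsMaximal → ∃ rs : List A,
    (∀ x ∈ rs, x ∈ P) ∧ RingTheory.Sequence.IsRegular A rs ∧
      (rs.length : ℕ∞) = idealHeight P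

def reesPresentation {A : Type*} [CommRing A] {n : ℕ} (f : Fin n → A) :
    MvPolynomial (Fin n) A →ₐ[A] Polynomial A :=
  MvPolynomial.aeval fun i => Polynomial.C (f i) * Polynomial.X

def Ideal.IsLinearType {A : Type*} [CommRing A] (I : Ideal A) : Prop :=
  ∀ (n : ℕ) (f : Fin n → A), Ideal.span (Set.range f) = I →
    RingHom.ker (reesPresentation f) =
      Ideal.span {p | p ∈ RingHom.ker (reesPresentation f) ∧ p.IsHomogeneous 1}

def moduleDepth {A : Type*} [CommRing A] (J : Ideal A) (M : Type*)
    [AddCommGroup M] [Module A M] : ℕ∞ :=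
  sSup {c : ℕ∞ | ∃ rs : List A, (∀ x ∈ rs, x ∈ J) ∧
    RingTheory.Sequence.IsRegular M rs ∧ (rs.length : ℕ∞) = c}

def analyticSpread {A : Type*} [CommRing A] (m I : Ideal A) : WithBot ℕ∞ :=
  ringKrullDim ((reesAlgebra I) ⧸ (Ideal.map (algebraMap A (reesAlgebra I)) m))

section Points

variable {k : Type*} [Field k]

def gradedPiece (I : Ideal (MvPolynomial (Fin 3) k)) (t : ℕ) :
    Submodule k (MvPolynomial (Fin 3) k) :=
  Submodule.restrictScalars k I ⊓ homogeneousSubmodule (Fin 3) k t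

def pointIdeal (p : Fin 3 → k) : Ideal (MvPolynomial (Fin 3) k) :=
  Ideal.span {f | f.IsHomogeneous 1 ∧ MvPolynomial.eval p f = 0}

def vanishingIdeal {n : ℕ} (pts : Fin n → (Fin 3 → k)) : Ideal (MvPolynomial (Fin 3) k) :=
  ⨅ i, pointIdeal (pts i)

def oneTimesPiece (I : Ideal (MvPolynomial (Fin 3) k)) (s : ℕ) :
    Submodule k (MvPolynomial (Fin 3) k) :=
  Submodule.span k {g | ∃ ℓ f, ℓ ∈ homogeneousSubmodule (Fin 3) k 1 ∧
    f ∈ gradedPiece I s ∧ g = ℓ * f}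

def IsPointFamily {n : ℕ} (pts : Fin n → (Fin 3 → k)) : Prop :=
  (∀ i, pts i ≠ 0) ∧ ∀ i j, i ≠ j → ∀ c : k, pts i ≠ c • pts j

def InGenericPosition {n : ℕ} (pts : Fin n → (Fin 3 → k)) : Prop :=
  ∀ t : ℕ, Module.finrank k (gradedPiece (vanishingIdeal pts) t) = (t + 2).choose 2 - n

def InUniformPosition {n : ℕ} (pts : Fin n → (Fin 3 → k)) : Prop :=
  ∀ T : Finset (Fin n), ∀ t : ℕ,
    Module.finrank k (gradedPiece (⨅ i ∈ T, pointIdeal (pts i)) t) = (t + 2).choose 2 - T.card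

def HasInitialDegree (I : Ideal (MvPolynomial (Fin 3) k)) (s : ℕ) : Prop :=
  gradedPiece I s ≠ ⊥ ∧ ∀ t < s, gradedPiece I t = ⊥

def InTightGenericPosition {n : ℕ} (pts : Fin n → (Fin 3 → k)) (s : ℕ) : Prop :=
  InGenericPosition pts ∧
    Module.finrank k (oneTimesPiece (vanishingIdeal pts) s) =
      min (3 * Module.finrank k (gradedPiece (vanishingIdeal pts) s))
        (Module.finrank k (gradedPiece (vanishingIdeal pts) (s + 1)))

def IsBirationalOntoImage {N : ℕ} (f : Fin N → MvPolynomial (Fin 3) k) : Prop :=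
  ∃ (e : ℕ) (G : Fin 3 → MvPolynomial (Fin N) k) (w : MvPolynomial (Fin 3) k),
    w ≠ 0 ∧ (∀ j, (G j).IsHomogeneous e) ∧
      ∀ j, MvPolynomial.aeval f (G j) = w * MvPolynomial.X j

end Points

end

theorem ringKrullDim_le_of_isIntegral (A B : Type*) [CommRing A] [CommRing B] [Algebra A B]
    [Algebra.IsIntegral A B] : ringKrullDim B ≤ ringKrullDim A :=
  Order.krullDim_le_of_strictMono (PrimeSpectrum.comap (algebraMap A B)) fun P Q hPQ =>
    Ideal.IsIntegral.comap_lt_comap (R := A) (I := P.asIdeal) (J := Q.asIdeal) hPQ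

theorem exists_ltSeries_comap_last_eq (A B : Type*) [CommRing A] [CommRing B] [Algebra A B]
    [Algebra.IsIntegral A B] (hinj : Function.Injective (algebraMap A B)) (n : ℕ)
    (p : LTSeries (PrimeSpectrum A)) (hp : p.length = n) :
    ∃ q : LTSeries (PrimeSpectrum B), q.length = n ∧
      PrimeSpectrum.comap (algebraMap A B) q.last = p.last := by
  induction n generalizing p with
  | zero =>
    obtain ⟨Q, -, hQ, hQp⟩ := Ideal.exists_ideal_over_prime_of_isIntegral (S := B)
      p.last.asIdeal ⊥ (by
        rw [← RingHom.ker_eq_comap_bot, (RingHom.injective_iff_ker_eq_bot _).1 hinj]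
        exact bot_le)
    exact ⟨RelSeries.singleton _ ⟨Q, hQ⟩, rfl, PrimeSpectrum.ext hQp⟩
  | succ n ih =>
    obtain ⟨q, hq, hlast⟩ := ih p.eraseLast (by simp [hp])
    have hlt : p.eraseLast.last < p.last := p.eraseLast_last_rel_last (by omega)
    obtain ⟨Q, hqQ, hQ, hQp⟩ := Ideal.exists_ideal_over_prime_of_isIntegral (S := B)
      p.last.asIdeal q.last.asIdeal
      (show (PrimeSpectrum.comap (algebraMap A B) q.last).asIdeal ≤ _ from hlast ▸ hlt.le)
    have hcomap : PrimeSpectrum.comap (algebraMap A B) ⟨Q, hQ⟩ = p.last := PrimeSpectrum.ext hQp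
    refine ⟨q.snoc ⟨Q, hQ⟩ (lt_of_le_of_ne hqQ fun h => hlt.ne ?_), by simp [hq], by simpa⟩
    rw [← hlast, ← hcomap]
    exact congrArg _ (PrimeSpectrum.ext h)

theorem ringKrullDim_le_of_isIntegral_of_injective (A B : Type*) [CommRing A] [CommRing B]
    [Algebra A B] [Algebra.IsIntegral A B] (hinj : Function.Injective (algebraMap A B)) :
    ringKrullDim A ≤ ringKrullDim B := by
  refine iSup_le fun p => ?_
  obtain ⟨q, hq, -⟩ := exists_ltSeries_comap_last_eq A B hinj p.length p rfl
  exact hq ▸ le_iSup (fun q : LTSeries (PrimeSpectrum B) => ((q.length : ℕ) : WithBot ℕ∞)) q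

universe u in
theorem ringKrullDim_eq_trdeg (k B : Type u) [Field k] [CommRing B] [IsDomain B] [Algebra k B]
    [Algebra.FiniteType k B] :
    ∃ r : ℕ, ringKrullDim B = r ∧ Algebra.trdeg k B = r := by
  obtain ⟨r, φ, hinj, hint⟩ := exists_integral_inj_algHom_of_fg k B
  refine ⟨r, ?_, ?_⟩
  · have hdim : ringKrullDim (MvPolynomial (Fin r) k) = r := by
      simp [MvPolynomial.ringKrullDim_of_isNoetherianRing]
    let _ := φ.toRingHom.toAlgebra
    have : Algebra.IsIntegral (MvPolynomial (Fin r) k) B := ⟨hint⟩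
    rw [← hdim]
    exact le_antisymm (ringKrullDim_le_of_isIntegral _ _)
      (ringKrullDim_le_of_isIntegral_of_injective _ _ hinj)
  · have hx : AlgebraicIndependent k fun i => φ (MvPolynomial.X i) := by
      have := (MvPolynomial.algebraicIndependent_X (Fin r) k).map' hinj
      exact this
    have hrange : Algebra.adjoin k (Set.range fun i => φ (MvPolynomial.X i)) = φ.range := by
      rw [← Algebra.map_top, ← MvPolynomial.adjoin_range_X, AlgHom.map_adjoin, ← Set.range_comp]
      rfl
    have hint' : Algebra.IsAlgebraic
        (Algebra.adjoin k (Set.range fun i => φ (MvPolynomial.X i))) B := by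
      have : Algebra.IsIntegral
          (Algebra.adjoin k (Set.range fun i => φ (MvPolynomial.X i))) B := by
        rw [hrange]
        exact ⟨RingHom.IsIntegral.tower_top φ.rangeRestrict.toRingHom
          (algebraMap φ.range B) hint⟩
      infer_instance
    have hle := Algebra.IsAlgebraic.trdeg_le_cardinalMk k
      (Set.range fun i => φ (MvPolynomial.X i))
    have hge := hx.lift_cardinalMk_le_trdeg
    have hcard := Cardinal.mk_range_le_lift (f := fun i => φ (MvPolynomial.X i))
    simp only [Cardinal.mk_fin, Cardinal.lift_natCast] at hge hcard
    refine le_antisymm (hle.trans ?_) ?_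
    · simpa using hcard
    · simpa using hge

section Pencil

variable {k : Type*} {σ : Type*} [Field k]

theorem aeval_mul_left_of_isHomogeneous {A : Type*} [CommRing A] [Algebra k A]
    {G : MvPolynomial σ k} {m : ℕ} (hG : G.IsHomogeneous m) (t : A) (x : σ → A) :
    aeval (fun i => t * x i) G = t ^ m * aeval x G := by
  rw [aeval_def, aeval_def, eval₂_eq, eval₂_eq, Finset.mul_sum]
  refine Finset.sum_congr rfl fun d hd => ?_
  simp only [mul_pow, Finset.prod_mul_distrib, Finset.prod_pow_eq_pow_sum]
  rw [← hG.degree_eq_sum_deg_support hd]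
  ring

theorem infinite_setOf_prime_dvd_sub [Infinite k] {f g : MvPolynomial σ k} (hg : g ≠ 0)
    (hfg : ∀ a : k, f ≠ C a * g) :
    {a : k | ∃ c, Prime c ∧ c ∣ f - C a * g ∧ ∃ P, eval P c = 0 ∧ eval P g ≠ 0}.Infinite := by
  have hvalues : {a : k | ∃ P, eval P g ≠ 0 ∧ eval P f = a * eval P g}.Infinite := by
    intro hfin
    have hprod : g * ∏ a ∈ hfin.toFinset, (f - C a * g) = 0 := by
      refine MvPolynomial.funext fun P => ?_
      by_cases hP : eval P g = 0
      · simp [hP]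
      · rw [map_mul, map_prod, Finset.prod_eq_zero (i := eval P f / eval P g), mul_zero, map_zero]
        · exact hfin.mem_toFinset.2 ⟨P, hP, by field_simp⟩
        · simp [hP]
    rcases mul_eq_zero.1 hprod with h | h
    · exact hg h
    · obtain ⟨a, -, ha⟩ := Finset.prod_eq_zero_iff.1 h
      exact hfg a (sub_eq_zero.1 ha)
  refine hvalues.mono ?_
  rintro a ⟨P, hP, hPa⟩
  have hne : f - C a * g ≠ 0 := fun h => hfg a (sub_eq_zero.1 h)
  obtain ⟨u, hu⟩ := UniqueFactorizationMonoid.factors_prod hne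
  have heval : eval P (UniqueFactorizationMonoid.factors (f - C a * g)).prod = 0 := by
    have : eval P ((UniqueFactorizationMonoid.factors (f - C a * g)).prod * u) = 0 := by
      rw [hu]; simp [hPa]
    rw [map_mul] at this
    exact (mul_eq_zero.1 this).resolve_right (u.isUnit.map (eval P)).ne_zero
  rw [map_multiset_prod, Multiset.prod_eq_zero_iff, Multiset.mem_map] at heval
  obtain ⟨c, hc, hPc⟩ := heval
  exact ⟨c, UniqueFactorizationMonoid.prime_of_factor c hc,
    UniqueFactorizationMonoid.dvd_of_mem_factors hc, P, hPc, hP⟩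

theorem exists_eq_algebraMap_mul_of_aeval_eq_zero [IsAlgClosed k] {K : Type*} [Field K]
    [Algebra k K] {x y z : K} {a : k} (hx : x = algebraMap k K a * y) (hy : y ≠ 0)
    {G : MvPolynomial (Fin 3) k} {m : ℕ} (hG : G.IsHomogeneous m) (hrel : aeval ![x, y, z] G = 0)
    {b : k} (hb : eval ![a, 1, b] G ≠ 0) : ∃ e : k, z = algebraMap k K e * y := by
  let Q : Polynomial k := aeval ![Polynomial.C a, 1, Polynomial.X] G
  have hQ : Q ≠ 0 := by
    intro h0
    apply hb
    have : Polynomial.aeval b Q = eval ![a, 1, b] G := by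
      rw [← MvPolynomial.aeval_eq_eval, ← AlgHom.comp_apply]
      refine congrArg (fun ψ : MvPolynomial (Fin 3) k →ₐ[k] k => ψ G) ?_
      ext i
      fin_cases i <;> simp
    rw [← this, h0, map_zero]
  have hroot : Polynomial.aeval (z / y) Q = 0 := by
    have h1 : Polynomial.aeval (z / y) Q = aeval ![algebraMap k K a, 1, z / y] G := by
      rw [← AlgHom.comp_apply]
      refine congrArg (fun ψ : MvPolynomial (Fin 3) k →ₐ[k] K => ψ G) ?_
      ext i
      fin_cases i <;> simp
    have h2 : y ^ m * aeval ![algebraMap k K a, 1, z / y] G = 0 := by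
      rw [← aeval_mul_left_of_isHomogeneous hG, ← hrel]
      refine congrArg (fun w => aeval w G) (_root_.funext fun i => ?_)
      fin_cases i
      · simp [hx, mul_comm]
      · simp
      · simp [mul_div_cancel₀ _ hy]
    rw [h1]
    exact (mul_eq_zero.1 h2).resolve_left (pow_ne_zero _ hy)
  have hsplit : (Q.map (algebraMap k K)).IsRoot (z / y) := by
    rwa [Polynomial.IsRoot, Polynomial.eval_map_algebraMap]
  obtain ⟨e, he⟩ := (IsAlgClosed.splits Q).mem_range_of_isRoot hQ hsplit
  exact ⟨e, by rw [he, div_mul_cancel₀ _ hy]⟩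

theorem exists_dvd_sub_of_aeval_eq_zero [IsAlgClosed k] {f g h c : MvPolynomial σ k} {a : k}
    (hc : Prime c) (hcf : c ∣ f - C a * g) (hcg : ¬ c ∣ g) {G : MvPolynomial (Fin 3) k} {m : ℕ}
    (hG : G.IsHomogeneous m) (hrel : aeval ![f, g, h] G = 0) {b : k}
    (hb : eval ![a, 1, b] G ≠ 0) : ∃ e : k, c ∣ h - C e * g := by
  have : (Ideal.span {c}).IsPrime := (Ideal.span_singleton_prime hc.ne_zero).2 hc
  let π : MvPolynomial σ k →ₐ[k] FractionRing (MvPolynomial σ k ⧸ Ideal.span {c}) :=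
    (IsScalarTower.toAlgHom k (MvPolynomial σ k ⧸ Ideal.span {c}) _).comp
      (Ideal.Quotient.mkₐ k (Ideal.span {c}))
  have hπ : ∀ p, π p = 0 ↔ c ∣ p := fun p => by
    rw [← Ideal.mem_span_singleton, ← Ideal.Quotient.eq_zero_iff_mem]
    exact map_eq_zero_iff _ (IsFractionRing.injective (MvPolynomial σ k ⧸ Ideal.span {c})
      (FractionRing (MvPolynomial σ k ⧸ Ideal.span {c})))
  clear_value π
  have hsub : ∀ (p : MvPolynomial σ k) (e : k),
      c ∣ p - C e * g ↔ π p = algebraMap k _ e * π g := fun p e => by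
    rw [← hπ, map_sub, map_mul, sub_eq_zero, ← algebraMap_eq, π.commutes]
  have hrel' : aeval ![π f, π g, π h] G = 0 := by
    rw [← map_zero π, ← hrel, ← AlgHom.comp_apply]
    refine congrArg (fun ψ : MvPolynomial (Fin 3) k →ₐ[k] _ => ψ G) ?_
    rw [comp_aeval]
    refine congrArg aeval (_root_.funext fun i => ?_)
    fin_cases i <;> rfl
  obtain ⟨e, he⟩ := exists_eq_algebraMap_mul_of_aeval_eq_zero ((hsub f a).1 hcf)
    (mt (hπ g).1 hcg) hG hrel' hb
  exact ⟨e, (hsub h e).2 he⟩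

theorem exists_isHomogeneous_aeval_eq_zero {ι : Type*} {x : ι → MvPolynomial σ k} {s : ℕ}
    (hs : s ≠ 0) (hx : ∀ i, (x i).IsHomogeneous s) (hdep : ¬ AlgebraicIndependent k x) :
    ∃ (m : ℕ) (G : MvPolynomial ι k), G ≠ 0 ∧ G.IsHomogeneous m ∧ aeval x G = 0 := by
  rw [algebraicIndependent_iff] at hdep
  push Not at hdep
  obtain ⟨G, hG, hne⟩ := hdep
  obtain ⟨m, hm⟩ : ∃ m, homogeneousComponent m G ≠ 0 := by
    by_contra! h
    exact hne (by rw [← sum_homogeneousComponent G]; simp [h])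
  refine ⟨m, homogeneousComponent m G, hm, homogeneousComponent_isHomogeneous m G, ?_⟩
  have key := congrArg (homogeneousComponent (s * m)) hG
  rw [map_zero, ← sum_homogeneousComponent G, map_sum, map_sum] at key
  have hcomp : ∀ i, homogeneousComponent (s * m) (aeval x (homogeneousComponent i G)) =
      if s * m = s * i then aeval x (homogeneousComponent i G) else 0 := fun i =>
    homogeneousComponent_of_mem ((homogeneousComponent_isHomogeneous i G).aeval _ hx)
  simp only [hcomp, mul_right_inj' hs] at key
  rw [Finset.sum_ite_eq, if_pos] at key
  · exact key
  · rw [Finset.mem_range, Nat.lt_succ_iff]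
    by_contra! h
    exact hm (homogeneousComponent_eq_zero _ _ h)

theorem exists_mem_iInf_totalDegree_lt [IsAlgClosed k] {ι : Type*} [Finite ι]
    (J : ι → Ideal (MvPolynomial σ k)) (hJ : ∀ i, (J i).IsPrime) {s : ℕ} (hs : s ≠ 0)
    {f g h : MvPolynomial σ k} (hhom : ∀ i, (![f, g, h] i).IsHomogeneous s)
    (hmem : ∀ i, ![f, g, h] i ∈ ⨅ j, J j) (hlin : LinearIndependent k ![f, g, h])
    (hdep : ¬ AlgebraicIndependent k ![f, g, h]) :
    ∃ q ∈ ⨅ j, J j, q ≠ 0 ∧ q.totalDegree < s := by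
  classical
  have : Infinite k := IsAlgClosed.instInfinite
  obtain ⟨m, G, hG0, hG, hrel⟩ := exists_isHomogeneous_aeval_eq_zero hs hhom hdep
  have hcomb : ∀ a b e : k, C a * f + C b * g + C e * h = 0 → a = 0 ∧ b = 0 ∧ e = 0 := by
    intro a b e habe
    have := Fintype.linearIndependent_iff.1 hlin ![a, b, e]
      (by simpa [Fin.sum_univ_three, MvPolynomial.smul_eq_C_mul] using habe)
    exact ⟨this 0, this 1, this 2⟩
  have hg : g ≠ 0 := fun h0 => one_ne_zero (hcomb 0 1 0 (by simp [h0])).2.1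
  have hfg : ∀ a : k, f ≠ C a * g := fun a h0 =>
    one_ne_zero (hcomb 1 (-a) 0 (by rw [h0]; simp)).1
  obtain ⟨q, b, hq⟩ : ∃ (q : Polynomial k) (b : k), q ≠ 0 ∧
      ∀ a, q.eval a ≠ 0 → eval ![a, 1, b] G ≠ 0 := by
    obtain ⟨P, hP⟩ : ∃ P, eval P (X 1 * G) ≠ 0 := by
      by_contra! h0
      exact mul_ne_zero (X_ne_zero 1) hG0 (MvPolynomial.funext fun P => by simpa using h0 P)
    rw [map_mul, eval_X] at hP
    have hP1 := left_ne_zero_of_mul hP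
    have heval : ∀ a, (aeval ![Polynomial.X, 1, Polynomial.C (P 2 / P 1)] G).eval a =
        eval ![a, 1, P 2 / P 1] G := fun a => by
      rw [← Polynomial.coe_aeval_eq_eval, ← MvPolynomial.aeval_eq_eval]
      change ((Polynomial.aeval a).comp (aeval _)) G = _
      refine congrArg (fun ψ : MvPolynomial (Fin 3) k →ₐ[k] k => ψ G) ?_
      ext i
      fin_cases i <;> simp
    refine ⟨aeval ![Polynomial.X, 1, Polynomial.C (P 2 / P 1)] G, P 2 / P 1, fun h0 => ?_,
      fun a ha => by rwa [← heval]⟩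
    have h1 : eval ![P 0 / P 1, 1, P 2 / P 1] G = 0 := by rw [← heval, h0, Polynomial.eval_zero]
    have h2 := aeval_mul_left_of_isHomogeneous (A := k) hG (P 1) ![P 0 / P 1, 1, P 2 / P 1]
    rw [MvPolynomial.aeval_eq_eval, MvPolynomial.aeval_eq_eval, h1, mul_zero] at h2
    refine right_ne_zero_of_mul hP (Eq.trans ?_ h2)
    refine congrArg (fun Q => eval Q G) (_root_.funext fun i => ?_)
    fin_cases i <;> simp [mul_div_cancel₀ _ hP1]
  obtain ⟨hq0, hq⟩ := hq
  have hinf := (infinite_setOf_prime_dvd_sub hg hfg).sdiff q.roots.toFinset.finite_toSet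
  choose! c hc hcf P hcP hgP using
    fun a (ha : a ∈ {a : k | ∃ c, Prime c ∧ c ∣ f - C a * g ∧ ∃ P, eval P c = 0 ∧ eval P g ≠ 0}) =>
      ha
  obtain ⟨a, ⟨ha, haq⟩, a', ⟨ha', haq'⟩, hne, hpat⟩ :=
    hinf.exists_ne_map_eq_of_mapsTo (f := fun a => {j : ι | c a ∈ J j}) (t := Set.univ)
      (fun _ _ => Set.mem_univ _) Set.finite_univ
  have hcg : ∀ a, eval (P a) (c a) = 0 → eval (P a) g ≠ 0 → ¬ c a ∣ g := by
    rintro a h0 h1 ⟨w, hw⟩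
    exact h1 (by rw [hw, map_mul, h0, zero_mul])
  have hroot : ∀ a, a ∉ (q.roots.toFinset : Set k) → q.eval a ≠ 0 := fun a h0 h1 =>
    h0 (by simpa [hq0] using h1)
  have hcga := hcg a (hcP a ha) (hgP a ha)
  have hcga' := hcg a' (hcP a' ha') (hgP a' ha')
  obtain ⟨e, he⟩ := exists_dvd_sub_of_aeval_eq_zero (hc a ha) (hcf a ha) hcga hG hrel
    (hq a (hroot a haq))
  obtain ⟨e', he'⟩ := exists_dvd_sub_of_aeval_eq_zero (hc a' ha') (hcf a' ha') hcga' hG hrel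
    (hq a' (hroot a' haq'))
  -- The member of the net divisible by both prime factors.
  set v := C (a - a') * (h - C e * g) - C (e - e') * (f - C a * g) with hv
  have hv_alt : v = C (a - a') * (h - C e' * g) - C (e - e') * (f - C a' * g) := by
    simp only [hv, map_sub]; ring
  have hv_comb : v = C (-(e - e')) * f + C ((e - e') * a - (a - a') * e) * g + C (a - a') * h := by
    simp only [hv, map_sub, map_mul, map_neg]; ring
  have hv0 : v ≠ 0 := fun h0 => hne (sub_eq_zero.1 (hcomb _ _ _ (hv_comb ▸ h0)).2.2)
  have hdvd : c a ∣ v := dvd_sub (he.mul_left _) ((hcf a ha).mul_left _)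
  have hdvd' : c a' ∣ v := hv_alt ▸ dvd_sub (he'.mul_left _) ((hcf a' ha').mul_left _)
  have hcc : ¬ c a' ∣ c a := by
    intro h0
    have h1 : c a' ∣ C (a - a') * g := by
      have := dvd_sub (hcf a' ha') (h0.trans (hcf a ha))
      rwa [show f - C a' * g - (f - C a * g) = C (a - a') * g by rw [map_sub]; ring] at this
    rcases (hc a' ha').dvd_or_dvd h1 with h2 | h2
    · exact (hc a' ha').not_isUnit
        (isUnit_of_dvd_unit h2 ((IsUnit.mk0 _ (sub_ne_zero.2 hne)).map C))
    · exact hcga' h2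
  obtain ⟨w, hw⟩ := hdvd
  obtain ⟨w', rfl⟩ : c a' ∣ w := ((hc a' ha').dvd_or_dvd (hw ▸ hdvd')).resolve_left hcc
  have hvJ : v ∈ ⨅ j, J j := by
    rw [hv_comb]
    exact add_mem (add_mem (Ideal.mul_mem_left _ _ (hmem 0)) (Ideal.mul_mem_left _ _ (hmem 1)))
      (Ideal.mul_mem_left _ _ (hmem 2))
  have hvhom : v.IsHomogeneous s := by
    rw [hv_comb]
    exact (((hhom 0).C_mul _).add ((hhom 1).C_mul _)).add ((hhom 2).C_mul _)
  have hvq : v = c a' * (c a * w') := by rw [hw]; ring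
  have hq0' : c a * w' ≠ 0 := right_ne_zero_of_mul (hvq ▸ hv0)
  refine ⟨c a * w', ?_, hq0', ?_⟩
  · rw [Ideal.mem_iInf] at hvJ ⊢
    intro j
    rcases (hJ j).mem_or_mem (hvq ▸ hvJ j) with h0 | h0
    · exact Ideal.mul_mem_right _ _ ((Set.ext_iff.1 hpat j).2 h0)
    · exact h0
  · have hdeg := hvhom.totalDegree hv0
    rw [hvq, totalDegree_mul_of_isDomain (hc a' ha').ne_zero hq0'] at hdeg
    have : (c a').totalDegree ≠ 0 := by
      intro h0
      rw [totalDegree_eq_zero_iff_eq_C] at h0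
      have h1 := hcP a' ha'
      rw [h0, eval_C] at h1
      exact (hc a' ha').ne_zero (by rw [h0, h1, C_0])
    omega

end Pencil

section InitialForms

variable {k : Type*} {σ : Type*} [Field k]

theorem homogeneousComponent_eq_zero_of_mem_pow {n j : ℕ} {a : MvPolynomial σ k}
    (ha : a ∈ idealOfVars σ k ^ n) (hj : j < n) : homogeneousComponent j a = 0 := by
  ext d
  rw [coeff_homogeneousComponent, coeff_zero]
  split_ifs with hd
  · exact (mem_pow_idealOfVars_iff' n a).1 ha d (hd ▸ hj)
  · rfl

theorem sub_homogeneousComponent_mem_pow_succ {n : ℕ} {a : MvPolynomial σ k}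
    (ha : a ∈ idealOfVars σ k ^ n) :
    a - homogeneousComponent n a ∈ idealOfVars σ k ^ (n + 1) := by
  rw [mem_pow_idealOfVars_iff'] at ha ⊢
  intro d hd
  rw [coeff_sub, coeff_homogeneousComponent]
  split_ifs with hdn
  · exact sub_self _
  · rw [ha d (by omega), sub_zero]

theorem homogeneousComponent_add_mul_of_mem_pow {m n : ℕ} {a b : MvPolynomial σ k}
    (ha : a ∈ idealOfVars σ k ^ m) (hb : b ∈ idealOfVars σ k ^ n) :
    homogeneousComponent (m + n) (a * b) =
      homogeneousComponent m a * homogeneousComponent n b := by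
  have ha' := sub_homogeneousComponent_mem_pow_succ ha
  have hb' := sub_homogeneousComponent_mem_pow_succ hb
  have hhom : homogeneousComponent m a ∈ idealOfVars σ k ^ m := by
    simpa using sub_mem ha (Ideal.pow_le_pow_right (Nat.le_succ m) ha')
  have hrest : a * b - homogeneousComponent m a * homogeneousComponent n b ∈
      idealOfVars σ k ^ (m + n + 1) := by
    have h1 := Ideal.mul_mem_mul ha' hb
    have h2 := Ideal.mul_mem_mul hhom hb'
    rw [← pow_add] at h1 h2
    convert add_mem (show _ ∈ idealOfVars σ k ^ (m + n + 1) by convert h1 using 2; ring)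
      (show _ ∈ idealOfVars σ k ^ (m + n + 1) by rwa [add_assoc]) using 1
    ring
  have h0 := homogeneousComponent_eq_zero_of_mem_pow hrest (Nat.lt_succ_self _)
  rw [map_sub, sub_eq_zero] at h0
  rw [h0]
  exact homogeneousComponent_eq_self
    ((homogeneousComponent_isHomogeneous m a).mul (homogeneousComponent_isHomogeneous n b))

/-- The map of the Rees algebra of an ideal of initial degree at least `s` to the polynomial ring
sending `a tⁱ` to the component of `a` of degree `i s`. -/
noncomputable def reesInitialForm (I : Ideal (MvPolynomial σ k)) (s : ℕ)
    (hI : I ≤ idealOfVars σ k ^ s) : reesAlgebra I →ₐ[k] MvPolynomial σ k :=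
  AlgHom.ofLinearMap
    ((Polynomial.lsum fun i => homogeneousComponent (i * s)).comp
      ((reesAlgebra I).val.restrictScalars k).toLinearMap)
    (by
      change Polynomial.lsum (fun i => homogeneousComponent (i * s))
        (1 : Polynomial (MvPolynomial σ k)) = 1
      rw [← Polynomial.C_1, ← Polynomial.monomial_zero_left, Polynomial.lsum_apply,
        Polynomial.sum_monomial_index _ _ (LinearMap.map_zero _), zero_mul,
        homogeneousComponent_zero, coeff_zero_one, C_1])
    (by
      rintro ⟨p, hp⟩ ⟨q, hq⟩
      change Polynomial.lsum (fun i => homogeneousComponent (i * s)) (p * q) =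
        Polynomial.lsum (fun i => homogeneousComponent (i * s)) p *
          Polynomial.lsum (fun i => homogeneousComponent (i * s)) q
      have hmem : ∀ {r : Polynomial (MvPolynomial σ k)}, r ∈ reesAlgebra I →
          ∀ i, r.coeff i ∈ idealOfVars σ k ^ (i * s) := fun hr i => by
        rw [mul_comm, pow_mul]
        exact Ideal.pow_right_mono hI i ((mem_reesAlgebra_iff I _).1 hr i)
      have hmono : ∀ i (a : MvPolynomial σ k),
          Polynomial.lsum (fun i => homogeneousComponent (i * s)) (Polynomial.monomial i a) =
            homogeneousComponent (i * s) a := fun i a =>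
        (Polynomial.lsum_apply _ _).trans (Polynomial.sum_monomial_index _ _ (map_zero _))
      conv_lhs => rw [p.as_sum_support, q.as_sum_support]
      rw [Finset.sum_mul_sum, Polynomial.lsum_apply _ p, Polynomial.lsum_apply _ q,
        Polynomial.sum_def, Polynomial.sum_def, Finset.sum_mul_sum, map_sum]
      refine Finset.sum_congr rfl fun i _ => ?_
      rw [map_sum]
      refine Finset.sum_congr rfl fun j _ => ?_
      rw [Polynomial.monomial_mul_monomial, hmono, add_mul]
      exact homogeneousComponent_add_mul_of_mem_pow (hmem hp i) (hmem hq j))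

theorem reesInitialForm_apply_monomial {I : Ideal (MvPolynomial σ k)} {s : ℕ}
    (hI : I ≤ idealOfVars σ k ^ s) {i : ℕ} {a : MvPolynomial σ k} (ha : a ∈ I ^ i) :
    reesInitialForm I s hI ⟨Polynomial.monomial i a, reesAlgebra.monomial_mem.2 ha⟩ =
      homogeneousComponent (i * s) a :=
  (Polynomial.lsum_apply _ _).trans (Polynomial.sum_monomial_index _ _ (map_zero _))

theorem reesInitialForm_algebraMap {I : Ideal (MvPolynomial σ k)} {s : ℕ}
    (hI : I ≤ idealOfVars σ k ^ s) (a : MvPolynomial σ k) :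
    reesInitialForm I s hI (algebraMap _ _ a) = C (coeff 0 a) := by
  rw [← homogeneousComponent_zero, ← zero_mul s,
    ← reesInitialForm_apply_monomial hI (i := 0) (a := a) (by simp)]
  rfl

variable [Finite σ]

theorem finiteType_reesAlgebra (I : Ideal (MvPolynomial σ k)) :
    Algebra.FiniteType k (reesAlgebra I) :=
  Algebra.FiniteType.trans (S := MvPolynomial σ k) inferInstance
    ((reesAlgebra I).fg_iff_finiteType.1 (reesAlgebra.fg (IsNoetherian.noetherian I)))

end InitialForms

theorem le_analyticSpread_of_algebraicIndependent {k : Type*} [Field k] {n : ℕ}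
    {I : Ideal (MvPolynomial (Fin n) k)} {s : ℕ} (hI : I ≤ idealOfVars (Fin n) k ^ s) {r : ℕ}
    {x : Fin r → MvPolynomial (Fin n) k} (hxI : ∀ i, x i ∈ I) (hxs : ∀ i, (x i).IsHomogeneous s)
    (hx : AlgebraicIndependent k x) : (r : WithBot ℕ∞) ≤ analyticSpread (idealOfVars (Fin n) k) I := by
  have := finiteType_reesAlgebra I
  let ρ := reesInitialForm I s hI
  have : Algebra.FiniteType k ρ.range :=
    Algebra.FiniteType.of_surjective ρ.rangeRestrict ρ.rangeRestrict_surjective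
  have hkill : Ideal.map (algebraMap _ (reesAlgebra I)) (idealOfVars (Fin n) k) ≤
      RingHom.ker ρ.rangeRestrict := by
    rw [Ideal.map_le_iff_le_comap, idealOfVars, Ideal.span_le]
    rintro _ ⟨i, rfl⟩
    refine Subtype.ext ((reesInitialForm_algebraMap hI _).trans ?_)
    simp
  have hdim : ringKrullDim ρ.range ≤ analyticSpread (idealOfVars (Fin n) k) I :=
    ringKrullDim_le_of_surjective
      (Ideal.Quotient.lift _ (ρ.rangeRestrict : reesAlgebra I →+* ρ.range) fun a ha => hkill ha)
      (Ideal.Quotient.lift_surjective_of_surjective _ _ ρ.rangeRestrict_surjective)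
  have hmem : ∀ i, x i ∈ ρ.range := fun i =>
    have hi : x i ∈ I ^ 1 := (pow_one I).symm ▸ hxI i
    ⟨⟨Polynomial.monomial 1 (x i), reesAlgebra.monomial_mem.2 hi⟩,
      (reesInitialForm_apply_monomial hI hi).trans
        ((one_mul s).symm ▸ homogeneousComponent_eq_self (hxs i))⟩
  have hind : AlgebraicIndependent k fun i => (⟨x i, hmem i⟩ : ρ.range) :=
    AlgebraicIndependent.of_comp ρ.range.val hx
  obtain ⟨d, hd, htr⟩ := ringKrullDim_eq_trdeg k ρ.range
  have hle := hind.lift_cardinalMk_le_trdeg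
  rw [htr] at hle
  have hrd : r ≤ d := by simpa using hle
  exact le_trans (by exact_mod_cast hrd) (hd ▸ hdim)

theorem analyticSpread_le_card {k : Type*} [Field k] {n : ℕ}
    (I : Ideal (MvPolynomial (Fin (n + 1)) k)) :
    analyticSpread (idealOfVars (Fin (n + 1)) k) I ≤ (n + 1 : ℕ) := by
  have := finiteType_reesAlgebra I
  obtain ⟨d, hd, htr⟩ := ringKrullDim_eq_trdeg k (reesAlgebra I)
  have hle : d ≤ n + 2 := by
    have h1 := trdeg_le_of_injective
      ((reesAlgebra I).val.restrictScalars k) Subtype.val_injective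
    rw [htr, ← (finSuccEquiv k (n + 1)).trdeg_eq, MvPolynomial.trdeg_of_isDomain,
      Cardinal.mk_fin, Cardinal.lift_natCast] at h1
    exact_mod_cast h1
  have hinj : Function.Injective (algebraMap (MvPolynomial (Fin (n + 1)) k) (reesAlgebra I)) :=
    FaithfulSMul.algebraMap_injective _ _
  have hX : algebraMap _ (reesAlgebra I) (X 0 : MvPolynomial (Fin (n + 1)) k) ∈
      nonZeroDivisors (reesAlgebra I) :=
    mem_nonZeroDivisors_of_ne_zero ((map_ne_zero_iff _ hinj).2 (X_ne_zero 0))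
  have hX0 : algebraMap _ (reesAlgebra I) (X 0 : MvPolynomial (Fin (n + 1)) k) ∈
      Ideal.map (algebraMap _ (reesAlgebra I)) (idealOfVars (Fin (n + 1)) k) :=
    Ideal.mem_map_of_mem _ (Ideal.subset_span (Set.mem_range_self 0))
  have hsucc : analyticSpread (idealOfVars (Fin (n + 1)) k) I + 1 ≤ ringKrullDim (reesAlgebra I) :=
    ringKrullDim_succ_le_of_surjective (Ideal.Quotient.mk _) Ideal.Quotient.mk_surjective hX
      (Ideal.Quotient.eq_zero_iff_mem.2 hX0)
  rw [hd] at hsucc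
  have : analyticSpread (idealOfVars (Fin (n + 1)) k) I + 1 ≤ ((n + 1 : ℕ) : WithBot ℕ∞) + 1 :=
    hsucc.trans (by exact_mod_cast hle)
  revert this
  cases analyticSpread (idealOfVars (Fin (n + 1)) k) I with
  | bot => exact fun _ => bot_le
  | coe x =>
    intro h
    exact_mod_cast (ENat.add_le_add_iff_right ENat.one_ne_top).1
      (show x + 1 ≤ ((n + 1 : ℕ) : ℕ∞) + 1 by exact_mod_cast h)

section PointIdeals

variable {k : Type*} [Field k]

/-- Restriction of polynomials to the line through the origin and `p`. -/
noncomputable def restrictToLine (p : Fin 3 → k) : MvPolynomial (Fin 3) k →ₐ[k] Polynomial k :=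
  aeval fun i => Polynomial.X * Polynomial.C (p i)

theorem restrictToLine_of_isHomogeneous {p : Fin 3 → k} {f : MvPolynomial (Fin 3) k} {t : ℕ}
    (hf : f.IsHomogeneous t) :
    restrictToLine p f = Polynomial.monomial t (eval p f) := by
  rw [restrictToLine, aeval_mul_left_of_isHomogeneous hf, ← Polynomial.C_mul_X_pow_eq_monomial,
    mul_comm]
  congr 1
  exact DFunLike.congr_fun (algHom_ext (f := aeval fun i => Polynomial.C (p i))
    (g := (Algebra.ofId k (Polynomial k)).comp (aeval p)) fun i => by simp [Algebra.ofId_apply]) f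

theorem pointIdeal_eq_ker {p : Fin 3 → k} (hp : p ≠ 0) :
    pointIdeal p = RingHom.ker (restrictToLine p) := by
  refine le_antisymm (Ideal.span_le.2 fun f hf => ?_) fun f hf => ?_
  · rw [SetLike.mem_coe, RingHom.mem_ker, restrictToLine_of_isHomogeneous hf.1, hf.2,
      Polynomial.monomial_zero_right]
  · obtain ⟨j, hj⟩ := Function.ne_iff.1 hp
    let ψ : Polynomial k →ₐ[k] MvPolynomial (Fin 3) k := Polynomial.aeval (C (p j)⁻¹ * X j)
    have hmk : (Ideal.Quotient.mkₐ k (pointIdeal p)).comp (ψ.comp (restrictToLine p)) =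
        Ideal.Quotient.mkₐ k (pointIdeal p) := by
      refine algHom_ext fun i => Ideal.Quotient.eq.2 (Ideal.subset_span ?_)
      have hi : ψ (restrictToLine p (X i)) = C ((p j)⁻¹ * p i) * X j := by
        simp only [ψ, restrictToLine, aeval_X, map_mul, Polynomial.aeval_X, Polynomial.aeval_C,
          algebraMap_eq]
        ring
      change ψ (restrictToLine p (X i)) - X i ∈ _
      rw [hi]
      refine ⟨((isHomogeneous_X k j).C_mul _).sub (isHomogeneous_X k i), ?_⟩
      have hj' : p j ≠ 0 := hj
      simp only [map_sub, map_mul, eval_C, eval_X]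
      field_simp
      ring
    have h := DFunLike.congr_fun hmk f
    rw [AlgHom.comp_apply, AlgHom.comp_apply, (RingHom.mem_ker).1 hf, map_zero, map_zero] at h
    exact Ideal.Quotient.eq_zero_iff_mem.1 h.symm

theorem isPrime_pointIdeal {p : Fin 3 → k} (hp : p ≠ 0) : (pointIdeal p).IsPrime :=
  pointIdeal_eq_ker hp ▸ RingHom.ker_isPrime _

theorem homogeneousComponent_mem_pointIdeal {p : Fin 3 → k} (hp : p ≠ 0)
    {f : MvPolynomial (Fin 3) k} (hf : f ∈ pointIdeal p) (t : ℕ) :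
    homogeneousComponent t f ∈ pointIdeal p := by
  rw [pointIdeal_eq_ker hp, RingHom.mem_ker] at hf ⊢
  have hcomp : ∀ i, restrictToLine p (homogeneousComponent i f) =
      Polynomial.monomial i (eval p (homogeneousComponent i f)) := fun i =>
    restrictToLine_of_isHomogeneous (homogeneousComponent_isHomogeneous i f)
  rcases le_or_gt t f.totalDegree with ht | ht
  · have h := congrArg (Polynomial.coeff · t) hf
    simp only [Polynomial.coeff_zero] at h
    rw [← sum_homogeneousComponent f, map_sum, Polynomial.finsetSum_coeff] at h
    simp only [hcomp, Polynomial.coeff_monomial] at h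
    rw [Finset.sum_ite_eq', if_pos (Finset.mem_range.2 (Nat.lt_succ_of_le ht))] at h
    rw [hcomp, h, Polynomial.monomial_zero_right]
  · rw [homogeneousComponent_eq_zero _ _ ht, map_zero]

theorem homogeneousComponent_mem_gradedPiece {n : ℕ} {pts : Fin n → Fin 3 → k}
    (hpts : ∀ i, pts i ≠ 0) {f : MvPolynomial (Fin 3) k} (hf : f ∈ vanishingIdeal pts) (t : ℕ) :
    homogeneousComponent t f ∈ gradedPiece (vanishingIdeal pts) t := by
  refine ⟨?_, homogeneousComponent_mem t f⟩
  change homogeneousComponent t f ∈ vanishingIdeal pts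
  rw [_root_.vanishingIdeal, Ideal.mem_iInf] at hf ⊢
  exact fun i => homogeneousComponent_mem_pointIdeal (hpts i) (hf i) t

theorem homogeneousComponent_eq_zero_of_hasInitialDegree {n s : ℕ} {pts : Fin n → Fin 3 → k}
    (hpts : ∀ i, pts i ≠ 0) (hindeg : HasInitialDegree (vanishingIdeal pts) s)
    {f : MvPolynomial (Fin 3) k} (hf : f ∈ vanishingIdeal pts) {t : ℕ} (ht : t < s) :
    homogeneousComponent t f = 0 := by
  have := homogeneousComponent_mem_gradedPiece hpts hf t
  rwa [hindeg.2 t ht, Submodule.mem_bot] at this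

theorem vanishingIdeal_le_pow {n s : ℕ} {pts : Fin n → Fin 3 → k} (hpts : ∀ i, pts i ≠ 0)
    (hindeg : HasInitialDegree (vanishingIdeal pts) s) :
    vanishingIdeal pts ≤ idealOfVars (Fin 3) k ^ s := by
  intro f hf
  rw [mem_pow_idealOfVars_iff']
  intro d hd
  have := congrArg (coeff d)
    (homogeneousComponent_eq_zero_of_hasInitialDegree hpts hindeg hf hd)
  rwa [coeff_homogeneousComponent, if_pos rfl, coeff_zero] at this

theorem algebraicIndependent_of_hasInitialDegree [IsAlgClosed k] {n s : ℕ}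
    {pts : Fin n → Fin 3 → k} (hpts : ∀ i, pts i ≠ 0)
    (hindeg : HasInitialDegree (vanishingIdeal pts) s) (hs : s ≠ 0)
    {x : Fin 3 → MvPolynomial (Fin 3) k} (hx : ∀ i, x i ∈ gradedPiece (vanishingIdeal pts) s)
    (hlin : LinearIndependent k x) : AlgebraicIndependent k x := by
  by_contra hdep
  have hx3 : x = ![x 0, x 1, x 2] := by
    ext1 i
    fin_cases i <;> rfl
  rw [hx3] at hlin hdep hx
  obtain ⟨q, hq, hq0, hdeg⟩ := exists_mem_iInf_totalDegree_lt (fun i => pointIdeal (pts i))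
    (fun i => isPrime_pointIdeal (hpts i)) hs (fun i => (hx i).2) (fun i => (hx i).1) hlin hdep
  refine hq0 ?_
  rw [← sum_homogeneousComponent q]
  refine Finset.sum_eq_zero fun t ht => ?_
  rw [Finset.mem_range] at ht
  exact homogeneousComponent_eq_zero_of_hasInitialDegree hpts hindeg hq (by omega)

theorem exists_linearIndependent_gradedPiece {n s h : ℕ} {pts : Fin n → Fin 3 → k}
    (hgen : InGenericPosition pts) (hs : 3 ≤ s) (hn : n = (s + 1).choose 2 + h)
    (hh : 2 * h ≤ s) :
    ∃ x : Fin 3 → MvPolynomial (Fin 3) k, (∀ i, x i ∈ gradedPiece (vanishingIdeal pts) s) ∧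
      LinearIndependent k x := by
  have hdim : 3 ≤ Module.finrank k (gradedPiece (vanishingIdeal pts) s) := by
    have hchoose : (s + 2).choose 2 = (s + 1) + (s + 1).choose 2 := by
      rw [Nat.choose_succ_succ' (s + 1) 1, Nat.choose_one_right]
    rw [hgen s, hchoose]
    omega
  have : Module.Finite k (gradedPiece (vanishingIdeal pts) s) :=
    Module.finite_of_finrank_pos (by omega)
  let b := Module.finBasis k (gradedPiece (vanishingIdeal pts) s)
  refine ⟨fun i => b (Fin.castLE hdim i), fun i => (b _).2, ?_⟩
  exact (b.linearIndependent.comp _ (Fin.castLE_injective hdim)).map'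
    (Submodule.subtype _) (Submodule.ker_subtype _)

end PointIdeals

/-- Let `I ⊂ k[x,y,z]` be the radical ideal of `n` distinct points of `ℙ²`
in tight generic `n`-position, `n = C(s+1,2) + h` with `0 ≤ h ≤ s/2`, `s = indeg(I) ≥ 3`.
Then `I` has maximal analytic spread: `ℓ(I) = 3`. -/
theorem statement14 {k : Type*} [Field k] [IsAlgClosed k] {n s h : ℕ}
    (pts : Fin n → (Fin 3 → k)) (hfam : IsPointFamily pts)
    (htight : InTightGenericPosition pts s)
    (hindeg : HasInitialDegree (vanishingIdeal pts) s)
    (hs : 3 ≤ s) (hn : n = (s + 1).choose 2 + h) (hh : 2 * h ≤ s) :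
    analyticSpread
        (Ideal.span (Set.range (MvPolynomial.X : Fin 3 → MvPolynomial (Fin 3) k)))
        (vanishingIdeal pts) = (3 : WithBot ℕ∞) := by
  obtain ⟨x, hx, hlin⟩ := exists_linearIndependent_gradedPiece htight.1 hs hn hh
  have hle : analyticSpread (idealOfVars (Fin 3) k) (_root_.vanishingIdeal pts) ≤ (3 : ℕ) :=
    analyticSpread_le_card (n := 2) _
  have hge : ((3 : ℕ) : WithBot ℕ∞) ≤
      analyticSpread (idealOfVars (Fin 3) k) (_root_.vanishingIdeal pts) :=
    le_analyticSpread_of_algebraicIndependent (vanishingIdeal_le_pow hfam.1 hindeg)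
      (fun i => (hx i).1) (fun i => (hx i).2)
      (algebraicIndependent_of_hasInitialDegree hfam.1 hindeg (by omega) hx hlin)
  exact (le_antisymm hle hge).trans Nat.cast_ofNat
end

section
/- Let I ⊂ R = k[x,y,z] be the radical ideal of a set X of n distinct points of P² in tight generic n-position, and write n = C(s+1,2) + h where s = indeg(I) ≥ 3 and 0 ≤ h ≤ s/2 − 1. Then the rational map F : P² ⇢ P^{s−h} defined by a basis of the linear system I_s (which has dimension s−h+1) is birational onto its image. -/
open Matrix MvPolynomial

noncomputable section

/-- A family is primitive if its only common divisors are units. -/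
def IsPrimitiveFamily {A ι : Type*} [CommRing A] (y : ι → A) : Prop :=
  ∀ c, (∀ i, c ∣ y i) → IsUnit c

section UFD

variable {A ι : Type*} [CommRing A] [UniqueFactorizationMonoid A] [Fintype ι]

lemma exists_eq_smul_isPrimitiveFamily {v : ι → A} (hv : v ≠ 0) :
    ∃ (g : A) (u : ι → A), v = g • u ∧ IsPrimitiveFamily u := by
  have : IsGCDMonoid A := ⟨UniqueFactorizationMonoid.toGCDMonoid A⟩
  obtain ⟨_⟩ := (inferInstance : Nonempty (NormalizedGCDMonoid A))
  obtain ⟨i₀, -⟩ := Function.ne_iff.mp hv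
  obtain ⟨u, hu, hu1⟩ := Finset.extract_gcd v (s := Finset.univ) ⟨i₀, Finset.mem_univ _⟩
  refine ⟨Finset.univ.gcd v, u, funext fun i => hu i (Finset.mem_univ _), fun c hc => ?_⟩
  exact isUnit_of_dvd_one (hu1 ▸ Finset.dvd_gcd fun i _ => hc i)

lemma IsPrimitiveFamily.exists_eq_smul [IsDomain A] {y w : ι → A} (hy : IsPrimitiveFamily y)
    (h : ∀ i j, w i * y j = w j * y i) : ∃ c : A, w = c • y := by
  have : IsGCDMonoid A := ⟨UniqueFactorizationMonoid.toGCDMonoid A⟩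
  obtain ⟨_⟩ := (inferInstance : Nonempty (NormalizedGCDMonoid A))
  by_cases hy0 : y = 0
  · have : IsUnit (0 : A) := hy 0 (by simp [hy0])
    exact absurd this not_isUnit_zero
  obtain ⟨j, hj⟩ := Function.ne_iff.mp hy0
  have hunit : IsUnit (Finset.univ.gcd y) :=
    hy _ fun i => Finset.gcd_dvd (Finset.mem_univ i)
  have hdvd : y j ∣ w j := by
    have h1 : y j ∣ Finset.univ.gcd fun i => w j * y i :=
      Finset.dvd_gcd fun i _ => ⟨w i, by rw [← h i j, mul_comm]⟩
    exact (hunit.dvd_mul_right).mp (h1.trans (Finset.gcd_mul_left' _ _ _).dvd)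
  obtain ⟨c, hc⟩ := hdvd
  refine ⟨c, funext fun i => mul_right_cancel₀ hj ?_⟩
  rw [h i j, hc, Pi.smul_apply, smul_eq_mul]
  ring

end UFD

section Homogeneous

variable {k σ : Type*} [Field k]

lemma MvPolynomial.IsHomogeneous.of_mul_left {f g : MvPolynomial σ k} {n : ℕ}
    (h : (f * g).IsHomogeneous n) (hf : f ≠ 0) (hg : g ≠ 0) :
    f.IsHomogeneous f.totalDegree := by
  have hdeg : f.totalDegree + g.totalDegree = n := by
    rw [← totalDegree_mul_of_isDomain hf hg, h.totalDegree (mul_ne_zero hf hg)]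
  have hle (p : MvPolynomial σ k) (hp : p ≠ 0) :
      (p : MvPowerSeries σ k).order ≤ (p.totalDegree : ℕ∞) := by
    obtain ⟨d, hd⟩ := MvPolynomial.ne_zero_iff.mp hp
    refine (MvPowerSeries.order_le (d := d) (by simpa using hd)).trans ?_
    exact_mod_cast le_totalDegree (mem_support_iff.mpr hd)
  have hge : (n : ℕ∞) ≤ ((f * g : MvPolynomial σ k) : MvPowerSeries σ k).order := by
    refine MvPowerSeries.nat_le_order fun d hd => ?_
    rw [coeff_coe]
    exact h.coeff_eq_zero hd.ne
  rw [coe_mul, MvPowerSeries.order_mul] at hge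
  have hf' : (f.totalDegree : ℕ∞) ≤ (f : MvPowerSeries σ k).order := by
    have h1 := hle g hg
    have h2 := hle f hf
    lift (f : MvPowerSeries σ k).order to ℕ using ne_top_of_le_ne_top (by simp) h2 with x
    lift (g : MvPowerSeries σ k).order to ℕ using ne_top_of_le_ne_top (by simp) h1 with y
    norm_cast at *
    omega
  intro d hd
  have h3 : Finsupp.weight (1 : σ → ℕ) d = d.degree := by
    rw [Finsupp.degree_eq_weight_one]
    rfl
  have h1 : d.degree ≤ f.totalDegree := le_totalDegree (mem_support_iff.mpr hd)
  have h2 := hf'.trans (MvPowerSeries.order_le (d := d) (by simpa using hd))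
  exact h3.trans (le_antisymm h1 (by exact_mod_cast h2))

lemma MvPolynomial.IsHomogeneous.exists_of_mul {f g : MvPolynomial σ k} {n : ℕ}
    (h : (f * g).IsHomogeneous n) (hf : f ≠ 0) (hg : g ≠ 0) :
    ∃ d e, d + e = n ∧ f.IsHomogeneous d ∧ g.IsHomogeneous e :=
  ⟨_, _, by rw [← totalDegree_mul_of_isDomain hf hg, h.totalDegree (mul_ne_zero hf hg)],
    h.of_mul_left hf hg, (mul_comm f g ▸ h).of_mul_left hg hf⟩

lemma MvPolynomial.IsHomogeneous.of_mul_of_left {f g : MvPolynomial σ k} {d e : ℕ}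
    (h : (f * g).IsHomogeneous (d + e)) (hf : f ≠ 0) (hfd : f.IsHomogeneous d) :
    g.IsHomogeneous e := by
  rcases eq_or_ne g 0 with rfl | hg
  · exact isHomogeneous_zero _ _ _
  obtain ⟨d', e', hde, hd', he'⟩ := h.exists_of_mul hf hg
  obtain rfl := hd'.inj_right hfd hf
  obtain rfl : e' = e := by omega
  exact he'

lemma finrank_homogeneousSubmodule (t : ℕ) :
    Module.finrank k (homogeneousSubmodule (Fin 3) k t) = (t + 2).choose 2 := by
  have hset : {d : Fin 3 →₀ ℕ | d.degree = t} =
      ((Finset.univ : Finset (Fin 3)).finsuppAntidiag t : Set (Fin 3 →₀ ℕ)) := by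
    ext d
    simp [Finsupp.degree_eq_sum]
  rw [homogeneousSubmodule_eq_finsupp_supported, hset]
  rw [(AddMonoidAlgebra.supportedEquivFinsupp _).finrank_eq, Module.finrank_finsupp_self]
  simp only [Finset.coe_sort_coe, Fintype.card_coe, Finset.card_finsuppAntidiag_nat_eq_choose]
  rw [Finset.card_univ, Fintype.card_fin, show 3 + t - 1 = t + 2 by omega]
  exact Nat.choose_symm_add

instance (t : ℕ) : FiniteDimensional k (homogeneousSubmodule (Fin 3) k t) :=
  Module.Finite.iff_fg.mpr (homogeneousSubmodule_fg (Fin 3) k t)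

/-- Families of forms of degree `t`. -/
def homogeneousFamilies (k ι : Type*) [Field k] (t : ℕ) :
    Submodule k (ι → MvPolynomial (Fin 3) k) :=
  Submodule.pi Set.univ fun _ => homogeneousSubmodule (Fin 3) k t

lemma mem_homogeneousFamilies {ι : Type*} {t : ℕ} {w : ι → MvPolynomial (Fin 3) k} :
    w ∈ homogeneousFamilies k ι t ↔ ∀ i, (w i).IsHomogeneous t := by
  simp [homogeneousFamilies]

def homogeneousFamiliesEquiv (k ι : Type*) [Field k] (t : ℕ) :
    homogeneousFamilies k ι t ≃ₗ[k] (ι → homogeneousSubmodule (Fin 3) k t) where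
  toFun w i := ⟨w.1 i, mem_homogeneousFamilies.mp w.2 i⟩
  invFun w := ⟨fun i => w i, mem_homogeneousFamilies.mpr fun i => (w i).2⟩
  map_add' _ _ := rfl
  map_smul' _ _ := rfl
  left_inv _ := rfl
  right_inv _ := rfl

instance {ι : Type*} [Finite ι] (t : ℕ) : FiniteDimensional k (homogeneousFamilies k ι t) :=
  Module.Finite.equiv (homogeneousFamiliesEquiv k ι t).symm

lemma finrank_homogeneousFamilies (ι : Type*) [Fintype ι] (t : ℕ) :
    Module.finrank k (homogeneousFamilies k ι t) = Fintype.card ι * (t + 2).choose 2 := by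
  rw [(homogeneousFamiliesEquiv k ι t).finrank_eq, Module.finrank_pi_fintype]
  simp [finrank_homogeneousSubmodule]

lemma finrank_le_of_forall_eq_smul {ι : Type*} [Finite ι] {t e : ℕ}
    {y : ι → MvPolynomial (Fin 3) k} (hy0 : y ≠ 0) (hy : ∀ i, (y i).IsHomogeneous e)
    {S : Submodule k (ι → MvPolynomial (Fin 3) k)} (hS : S ≤ homogeneousFamilies k ι t)
    (h : ∀ w ∈ S, ∃ c : MvPolynomial (Fin 3) k, w = c • y) :
    Module.finrank k S ≤ (t + 2 - e).choose 2 := by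
  obtain ⟨j, hj⟩ := Function.ne_iff.mp hy0
  rcases lt_or_ge t e with hte | hte
  · have : S = ⊥ := by
      refine (Submodule.eq_bot_iff _).mpr fun w hw => ?_
      obtain ⟨c, rfl⟩ := h w hw
      by_contra hc
      have hc0 : c ≠ 0 := fun h0 => hc (by simp [h0])
      have h1 : (y j * c).IsHomogeneous t :=
        mul_comm c (y j) ▸ mem_homogeneousFamilies.mp (hS hw) j
      obtain ⟨d', e', hde, hd', -⟩ := h1.exists_of_mul hj hc0
      have := hd'.inj_right (hy j) hj
      omega
    rw [this, finrank_bot]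
    exact Nat.zero_le _
  · obtain ⟨r, rfl⟩ := Nat.exists_eq_add_of_le hte
    have hle : S ≤ (homogeneousSubmodule (Fin 3) k r).map
        ((LinearMap.toSpanSingleton (MvPolynomial (Fin 3) k) _ y).restrictScalars k) := by
      intro w hw
      obtain ⟨c, rfl⟩ := h w hw
      refine ⟨c, ?_, by simp⟩
      have h1 : (y j * c).IsHomogeneous (e + r) :=
        mul_comm c (y j) ▸ mem_homogeneousFamilies.mp (hS hw) j
      exact h1.of_mul_of_left hj (hy j)
    refine (Submodule.finrank_mono hle).trans ((Submodule.finrank_map_le _ _).trans ?_)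
    rw [finrank_homogeneousSubmodule, show e + r + 2 - e = r + 2 by omega]

end Homogeneous

section Syzygies

variable {k : Type*} [Field k]

lemma finrank_le_finrank_map_add_finrank_inf_ker {V V₂ : Type*} [AddCommGroup V] [Module k V]
    [AddCommGroup V₂] [Module k V₂] (T : V →ₗ[k] V₂) (S : Submodule k V)
    [FiniteDimensional k S] :
    Module.finrank k S ≤
      Module.finrank k (S.map T) + Module.finrank k (S ⊓ LinearMap.ker T : Submodule k V) := by
  rw [← (T.domRestrict S).finrank_range_add_finrank_ker, LinearMap.range_domRestrict,
    ← Submodule.finrank_map_subtype_eq S (LinearMap.ker (T.domRestrict S))]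
  refine Nat.add_le_add_left (Submodule.finrank_mono ?_) _
  rintro _ ⟨w, hw, rfl⟩
  exact ⟨w.2, by simpa using hw⟩

lemma mul_eq_mul_of_cross_eq_zero {A : Type*} [CommRing A] {p q : Fin 3 → A}
    (h : p ⨯₃ q = 0) (i j : Fin 3) : p i * q j = p j * q i := by
  rw [cross_apply] at h
  have h0 := congrFun h 0
  have h1 := congrFun h 1
  have h2 := congrFun h 2
  simp at h0 h1 h2
  fin_cases i <;> fin_cases j <;> simp <;> grind

lemma isHomogeneous_cross {σ : Type*} {v w : Fin 3 → MvPolynomial σ k} {d e : ℕ}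
    (hv : ∀ i, (v i).IsHomogeneous d) (hw : ∀ i, (w i).IsHomogeneous e) (i : Fin 3) :
    ((v ⨯₃ w) i).IsHomogeneous (d + e) := by
  rw [cross_apply]
  revert i
  simp only [Fin.forall_fin_succ]
  refine ⟨?_, ?_, ?_, fun i => i.elim0⟩
  · exact ((hv 1).mul (hw 2)).sub ((hv 2).mul (hw 1))
  · exact ((hv 2).mul (hw 0)).sub ((hv 0).mul (hw 2))
  · exact ((hv 0).mul (hw 1)).sub ((hv 1).mul (hw 0))

lemma isPrimitiveFamily_X :
    IsPrimitiveFamily (X : Fin 3 → MvPolynomial (Fin 3) k) := by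
  intro c hc
  have hirr : Irreducible (X 0 : MvPolynomial (Fin 3) k) := X_prime.irreducible
  obtain ⟨d, hd⟩ := hc 0
  rcases hirr.isUnit_or_isUnit hd with h | h
  · exact h
  · exfalso
    have h1 : (X 0 : MvPolynomial (Fin 3) k) ∣ X 1 := by
      refine dvd_trans ?_ (hc 1)
      rw [hd]
      exact (h.mul_right_dvd).mpr dvd_rfl
    rw [X_dvd_X] at h1
    simp at h1

lemma X_family_ne_zero : (X : Fin 3 → MvPolynomial (Fin 3) k) ≠ 0 :=
  Function.ne_iff.mpr ⟨0, X_ne_zero 0⟩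

/-- The crossed family of two families orthogonal to a primitive family is a multiple of it. -/
lemma IsPrimitiveFamily.exists_cross_eq_smul {A : Type*} [CommRing A] [IsDomain A]
    [UniqueFactorizationMonoid A] {v w y : Fin 3 → A} (hy : IsPrimitiveFamily y)
    (hv : v ⬝ᵥ y = 0) (hw : w ⬝ᵥ y = 0) : ∃ c : A, v ⨯₃ w = c • y := by
  refine hy.exists_eq_smul (mul_eq_mul_of_cross_eq_zero ?_)
  rw [cross_cross_eq_smul_sub_smul, hv, hw]
  simp

lemma finrank_orthogonal_le {t m : ℕ} {u : Fin 3 → MvPolynomial (Fin 3) k}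
    (hu : IsPrimitiveFamily u) (hu0 : u ≠ 0) (hum : ∀ i, (u i).IsHomogeneous m)
    (hXu : X ⬝ᵥ u = 0) {S : Submodule k (Fin 3 → MvPolynomial (Fin 3) k)}
    (hS : S ≤ homogeneousFamilies k (Fin 3) t) (h : ∀ w ∈ S, w ⬝ᵥ u = 0) :
    Module.finrank k S ≤ (t + 1).choose 2 + (t + 3 - m).choose 2 := by
  have : FiniteDimensional k S := Submodule.finiteDimensional_of_le hS
  obtain ⟨T, hT⟩ : ∃ T : (Fin 3 → MvPolynomial (Fin 3) k) →ₗ[k] (Fin 3 → MvPolynomial (Fin 3) k),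
      ∀ w, T w = w ⨯₃ X :=
    ⟨((crossProduct (R := MvPolynomial (Fin 3) k)).flip X).restrictScalars k, fun _ => rfl⟩
  have hmap : Module.finrank k (S.map T) ≤ (t + 1 + 2 - m).choose 2 := by
    refine finrank_le_of_forall_eq_smul hu0 hum ?_ ?_
    · rintro _ ⟨w, hw, rfl⟩
      rw [hT]
      exact mem_homogeneousFamilies.mpr
        (isHomogeneous_cross (mem_homogeneousFamilies.mp (hS hw)) (isHomogeneous_X k))
    · rintro _ ⟨w, hw, rfl⟩
      rw [hT]
      exact hu.exists_cross_eq_smul (h w hw) hXu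
  have hker : Module.finrank k (S ⊓ LinearMap.ker T : Submodule k _) ≤ (t + 2 - 1).choose 2 := by
    refine finrank_le_of_forall_eq_smul X_family_ne_zero (fun i => isHomogeneous_X k i)
      (inf_le_left.trans hS) ?_
    rintro w ⟨-, hw⟩
    exact isPrimitiveFamily_X.exists_eq_smul (mul_eq_mul_of_cross_eq_zero (hT w ▸ hw))
  have := finrank_le_finrank_map_add_finrank_inf_ker T S
  simp only [show t + 1 + 2 - m = t + 3 - m by omega, show t + 2 - 1 = t + 1 by omega] at *
  omega

lemma finrank_pair_relations_le {t d : ℕ} {a b : MvPolynomial (Fin 3) k}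
    (hab : IsRelPrime a b) (ha0 : a ≠ 0) (ha : a.IsHomogeneous d) (hb : b.IsHomogeneous d)
    {S : Submodule k (Fin 2 → MvPolynomial (Fin 3) k)}
    (hS : S ≤ homogeneousFamilies k (Fin 2) t) (h : ∀ w ∈ S, w 0 * a + w 1 * b = 0) :
    Module.finrank k S ≤ (t + 2 - d).choose 2 := by
  refine finrank_le_of_forall_eq_smul (y := ![b, -a]) (e := d) ?_ ?_ hS fun w hw => ?_
  · exact Function.ne_iff.mpr ⟨1, by simpa using ha0⟩
  · intro i
    fin_cases i
    · exact hb
    · exact ha.neg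
  · refine IsPrimitiveFamily.exists_eq_smul ?_ ?_
    · intro c hc
      exact hab (by simpa using hc 1) (by simpa using hc 0)
    · have := h w hw
      intro i j
      fin_cases i <;> fin_cases j <;> simp <;> grind

end Syzygies

section Counting

variable {k : Type*} [Field k]

/-- If forms `a`, `b` and forms `u 0, u 1, u 2` have no common nonzero multiples of degree
`D + M + 1`, then their multiples of that degree are independent. -/
lemma choose_add_choose_le {D M m d : ℕ} {u₀ u : Fin 3 → MvPolynomial (Fin 3) k}
    {a₀ b₀ a b e g : MvPolynomial (Fin 3) k}
    (hu : ∀ i, (u i).IsHomogeneous (M + 1)) (ha : a.IsHomogeneous (D + 1))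
    (hb : b.IsHomogeneous (D + 1))
    (hdisj : ∀ (w : Fin 3 → MvPolynomial (Fin 3) k) (z : Fin 2 → MvPolynomial (Fin 3) k),
      w ⬝ᵥ u = z 0 * a + z 1 * b → (w ⬝ᵥ u).IsHomogeneous (D + M + 1) → w ⬝ᵥ u = 0)
    (hue : u = e • u₀) (he : e ≠ 0) (hu₀ : IsPrimitiveFamily u₀) (hu₀0 : u₀ ≠ 0)
    (hum : ∀ i, (u₀ i).IsHomogeneous m) (hXu : X ⬝ᵥ u₀ = 0)
    (hag : a = g * a₀) (hbg : b = g * b₀) (hg : g ≠ 0) (hab : IsRelPrime a₀ b₀)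
    (ha₀0 : a₀ ≠ 0) (ha₀ : a₀.IsHomogeneous d) (hb₀ : b₀.IsHomogeneous d) :
    3 * (D + 2).choose 2 + 2 * (M + 2).choose 2 ≤
      (D + M + 3).choose 2 + (D + 1).choose 2 + (D + 3 - m).choose 2 + (M + 2 - d).choose 2 := by
  obtain ⟨T₁, hT₁⟩ : ∃ T : (Fin 3 → MvPolynomial (Fin 3) k) →ₗ[k] MvPolynomial (Fin 3) k,
      ∀ w, T w = w ⬝ᵥ u :=
    ⟨(Fintype.linearCombination (MvPolynomial (Fin 3) k) u).restrictScalars k, fun _ => rfl⟩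
  obtain ⟨T₂, hT₂⟩ : ∃ T : (Fin 2 → MvPolynomial (Fin 3) k) →ₗ[k] MvPolynomial (Fin 3) k,
      ∀ z, T z = z 0 * a + z 1 * b :=
    ⟨(Fintype.linearCombination (MvPolynomial (Fin 3) k) ![a, b]).restrictScalars k,
      fun _ => by simp [Fintype.linearCombination_apply]⟩
  have h₁ := finrank_le_finrank_map_add_finrank_inf_ker T₁ (homogeneousFamilies k (Fin 3) D)
  have h₂ := finrank_le_finrank_map_add_finrank_inf_ker T₂ (homogeneousFamilies k (Fin 2) M)
  have hk₁ : Module.finrank k (homogeneousFamilies k (Fin 3) D ⊓ LinearMap.ker T₁ :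
      Submodule k _) ≤ (D + 1).choose 2 + (D + 3 - m).choose 2 := by
    refine finrank_orthogonal_le hu₀ hu₀0 hum hXu inf_le_left ?_
    rintro w ⟨-, hw⟩
    have hw' : w ⬝ᵥ u = 0 := (hT₁ w).symm.trans hw
    rw [hue, dotProduct_smul, smul_eq_mul] at hw'
    exact (mul_eq_zero.mp hw').resolve_left he
  have hk₂ : Module.finrank k (homogeneousFamilies k (Fin 2) M ⊓ LinearMap.ker T₂ :
      Submodule k _) ≤ (M + 2 - d).choose 2 := by
    refine finrank_pair_relations_le hab ha₀0 ha₀ hb₀ inf_le_left ?_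
    rintro w ⟨-, hw⟩
    have hw' : w 0 * a + w 1 * b = 0 := (hT₂ w).symm.trans hw
    refine (mul_eq_zero.mp (?_ : g * _ = 0)).resolve_left hg
    rw [← hw', hag, hbg]
    ring
  have hhom₁ : (homogeneousFamilies k (Fin 3) D).map T₁ ≤
      homogeneousSubmodule (Fin 3) k (D + M + 1) := by
    rintro _ ⟨w, hw, rfl⟩
    rw [hT₁]
    exact IsHomogeneous.sum _ _ _ fun i _ => (mem_homogeneousFamilies.mp hw i).mul (hu i)
  have hhom₂ : (homogeneousFamilies k (Fin 2) M).map T₂ ≤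
      homogeneousSubmodule (Fin 3) k (D + M + 1) := by
    rintro _ ⟨w, hw, rfl⟩
    rw [hT₂, show D + M + 1 = M + (D + 1) by omega]
    have hw' := mem_homogeneousFamilies.mp hw
    exact ((hw' 0).mul ha).add ((hw' 1).mul hb)
  have hinf : (homogeneousFamilies k (Fin 3) D).map T₁ ⊓
      (homogeneousFamilies k (Fin 2) M).map T₂ = ⊥ := by
    refine (Submodule.eq_bot_iff _).mpr ?_
    rintro p ⟨hp, ⟨z, -, hz⟩⟩
    have hph := hhom₁ hp
    obtain ⟨w, -, hw⟩ := hp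
    rw [hT₁] at hw
    rw [hT₂] at hz
    subst hw
    exact hdisj w z hz.symm hph
  have hsum := Submodule.finrank_sup_add_finrank_inf_eq
    ((homogeneousFamilies k (Fin 3) D).map T₁) ((homogeneousFamilies k (Fin 2) M).map T₂)
  have hsup := Submodule.finrank_mono (sup_le hhom₁ hhom₂)
  rw [hinf, finrank_bot] at hsum
  rw [finrank_homogeneousSubmodule, show D + M + 1 + 2 = D + M + 3 from rfl] at hsup
  rw [finrank_homogeneousFamilies, Fintype.card_fin] at h₁ h₂
  omega

lemma two_mul_choose_two (n : ℕ) : 2 * (n + 1).choose 2 = (n + 1) * n := by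
  rw [mul_comm, Nat.choose_two_right, Nat.div_two_mul_two_of_even (Nat.even_mul_pred_self _)]
  rfl

lemma choose_lt_of_le {D M m d : ℕ} (hm : M + 1 = m) (hd : m ≤ d) (hdD : d ≤ D + 1) :
    (D + M + 3).choose 2 + (D + 1).choose 2 + (D + 3 - m).choose 2 + (M + 2 - d).choose 2 <
      3 * (D + 2).choose 2 + 2 * (M + 2).choose 2 := by
  subst hm
  obtain ⟨j, rfl⟩ : ∃ j, D = M + j := ⟨D - M, by omega⟩
  have h0 : (M + 2 - d).choose 2 = 0 := Nat.choose_eq_zero_of_lt (by omega)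
  have h1 := two_mul_choose_two (M + j + M + 2)
  have h2 := two_mul_choose_two (M + j)
  have h3 := two_mul_choose_two (j + 1)
  have h4 := two_mul_choose_two (M + j + 1)
  have h5 := two_mul_choose_two (M + 1)
  rw [h0, show M + j + 3 - (M + 1) = j + 1 + 1 by omega]
  norm_num [add_assoc] at *
  nlinarith

lemma choose_lt_of_gt {D M m d : ℕ} (hm : m ≤ M + 1) (hd : d < m) (hdD : d = D + 1) :
    (D + M + 3).choose 2 + (D + 1).choose 2 + (D + 3 - m).choose 2 + (M + 2 - d).choose 2 <
      3 * (D + 2).choose 2 + 2 * (M + 2).choose 2 := by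
  subst hdD
  obtain ⟨j, rfl⟩ : ∃ j, M = D + j := ⟨M - D, by omega⟩
  have h0 : (D + 3 - m).choose 2 = 0 := Nat.choose_eq_zero_of_lt (by omega)
  have h1 := two_mul_choose_two (D + (D + j) + 2)
  have h2 := two_mul_choose_two D
  have h3 := two_mul_choose_two j
  have h4 := two_mul_choose_two (D + 1)
  have h5 := two_mul_choose_two (D + j + 1)
  rw [h0, show D + j + 2 - (D + 1) = j + 1 by omega]
  norm_num [add_assoc] at *
  nlinarith

/-- Two independent families of forms of degree `s` that vanish at the given points and are
orthogonal to the coordinates are not proportional, when no form of degree `s - 1` vanishes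
at all the points. -/
lemma cross_ne_zero_of_linearIndependent {P : Type*} {s : ℕ} {pts : P → Fin 3 → k} (hs : 0 < s)
    (hbot : ∀ F : MvPolynomial (Fin 3) k, F.IsHomogeneous (s - 1) →
      (∀ p, eval (pts p) F = 0) → F = 0)
    {v v' : Fin 3 → MvPolynomial (Fin 3) k} (hv : ∀ i, (v i).IsHomogeneous s)
    (hv' : ∀ i, (v' i).IsHomogeneous s) (hvp : ∀ p i, eval (pts p) (v i) = 0)
    (hvp' : ∀ p i, eval (pts p) (v' i) = 0) (hXv : X ⬝ᵥ v = 0)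
    (hli : LinearIndependent k ![v, v']) : v ⨯₃ v' ≠ 0 := by
  intro hcross
  have hv0 : v ≠ 0 := hli.ne_zero 0
  have hv0' : v' ≠ 0 := hli.ne_zero 1
  obtain ⟨a, u, rfl, hu⟩ := exists_eq_smul_isPrimitiveFamily hv0
  have ha0 : a ≠ 0 := fun h => hv0 (by simp [h])
  have hu0 : u ≠ 0 := fun h => hv0 (by simp [h])
  obtain ⟨b, rfl⟩ : ∃ b : MvPolynomial (Fin 3) k, v' = b • u := by
    refine hu.exists_eq_smul fun i j => mul_left_cancel₀ ha0 ?_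
    have := mul_eq_mul_of_cross_eq_zero hcross i j
    simp only [Pi.smul_apply, smul_eq_mul] at this
    linear_combination -this
  have hXu : X ⬝ᵥ u = 0 := by
    rw [dotProduct_smul, smul_eq_mul] at hXv
    exact (mul_eq_zero.mp hXv).resolve_left ha0
  obtain ⟨i₀, hi₀⟩ := Function.ne_iff.mp hu0
  obtain ⟨d, m, hdm, had, him⟩ := (hv i₀).exists_of_mul ha0 hi₀
  have hum : ∀ i, (u i).IsHomogeneous m := fun i =>
    (hdm ▸ hv i : (a * u i).IsHomogeneous (d + m)).of_mul_of_left ha0 had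
  have hbd : b.IsHomogeneous d := by
    have h1 : (u i₀ * b).IsHomogeneous (m + d) := by
      rw [mul_comm, add_comm, hdm]
      exact hv' i₀
    exact h1.of_mul_of_left hi₀ him
  have hm : m ≠ 0 := by
    rintro rfl
    have hconst : ∀ i, ∃ c, u i = C c := fun i =>
      ⟨_, (totalDegree_eq_zero_iff_eq_C (p := u i)).mp
        (Nat.le_zero.mp (hum i).totalDegree_le)⟩
    choose c hc using hconst
    refine hu0 (funext fun i => ?_)
    have h1 := congrArg (coeff (Finsupp.single i 1)) hXu
    simp only [dotProduct, coeff_sum, hc, mul_comm (X _), coeff_C_mul, coeff_X, coeff_zero] at h1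
    simp only [Finsupp.single_left_inj one_ne_zero, mul_ite, mul_one, mul_zero,
      Finset.sum_ite_eq', Finset.mem_univ, if_true] at h1
    rw [hc, h1]
    simp
  have hb0 : b ≠ 0 := fun h => hv0' (by simp [h])
  obtain ⟨a', b', e, hab, hea, heb⟩ := UniqueFactorizationMonoid.exists_reduced_factors a ha0 b
  have ha0' : a' ≠ 0 := fun h => ha0 (by simp [← hea, h])
  have he0 : e ≠ 0 := fun h => ha0 (by simp [← hea, h])
  obtain ⟨δ, d', hδ, heδ, had'⟩ := (hea ▸ had : (e * a').IsHomogeneous d).exists_of_mul he0 ha0'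
  have hbd' : b'.IsHomogeneous d' :=
    (heb ▸ hδ ▸ hbd : (e * b').IsHomogeneous (δ + d')).of_mul_of_left he0 heδ
  have hd' : d' ≠ 0 := by
    rintro rfl
    have ha'' := (totalDegree_eq_zero_iff_eq_C (p := a')).mp (Nat.le_zero.mp had'.totalDegree_le)
    have hb'' := (totalDegree_eq_zero_iff_eq_C (p := b')).mp (Nat.le_zero.mp hbd'.totalDegree_le)
    have hca : coeff 0 a' ≠ 0 := fun h => ha0' (by rw [ha'', h, C_0])
    have := LinearIndependent.pair_iff.mp hli (coeff 0 b') (-coeff 0 a') (by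
      rw [← hea, ← heb, ha'', hb'']
      ext1 i
      simp only [Pi.add_apply, Pi.smul_apply, smul_eq_C_mul, smul_eq_mul, Pi.zero_apply, coeff_C,
        if_true, C_neg]
      ring)
    exact hca (neg_eq_zero.mp this.2)
  have hpt : ∀ p, (∀ i, eval (pts p) (u i) = 0) ∨ eval (pts p) e = 0 ∨
      (eval (pts p) a' = 0 ∧ eval (pts p) b' = 0) := by
    intro p
    by_contra! h
    obtain ⟨⟨i, hi⟩, hpe, hpab⟩ := h
    have h1 := hvp p i
    have h2 := hvp' p i
    simp only [Pi.smul_apply, smul_eq_mul, map_mul, mul_eq_zero, hi, or_false, ← hea, ← heb,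
      hpe, false_or] at h1 h2
    exact hpab h1 h2
  rcases le_or_gt m d' with hmd | hmd
  · obtain ⟨M, rfl⟩ := Nat.exists_eq_succ_of_ne_zero hm
    obtain ⟨D, rfl⟩ := Nat.exists_eq_succ_of_ne_zero (show d ≠ 0 by omega)
    refine absurd (choose_add_choose_le (e := 1) (g := e) hum had hbd ?_ (one_smul _ _).symm
      one_ne_zero hu hu0 hum hXu hea.symm heb.symm he0 hab ha0' had' hbd')
      (choose_lt_of_le rfl hmd (by omega)).not_ge
    intro w z hwz hw
    refine hbot _ (by convert hw using 1; omega) fun p => ?_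
    rcases hpt p with h | h | h
    · simp [dotProduct, h]
    · simp [hwz, ← hea, ← heb, h]
    · simp [hwz, ← hea, ← heb, h]
  · obtain ⟨M, hM⟩ := Nat.exists_eq_succ_of_ne_zero (show δ + m ≠ 0 by omega)
    obtain ⟨D, rfl⟩ := Nat.exists_eq_succ_of_ne_zero hd'
    refine absurd (choose_add_choose_le (u := e • u) (e := e) (g := 1)
      (fun i => hM ▸ heδ.mul (hum i)) had' hbd' ?_ rfl
      he0 hu hu0 hum hXu (one_mul _).symm (one_mul _).symm one_ne_zero hab ha0' had' hbd')
      (choose_lt_of_gt (by omega) hmd rfl).not_ge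
    intro w z hwz hw
    refine hbot _ (by convert hw using 1; omega) fun p => ?_
    rcases hpt p with h | h | h
    · simp [dotProduct, h]
    · simp [dotProduct, h]
    · simp [hwz, h]

end Counting

section Points

variable {k : Type*} [Field k]

lemma eval_eq_zero_of_mem_pointIdeal {p : Fin 3 → k} {F : MvPolynomial (Fin 3) k}
    (hF : F ∈ pointIdeal p) : eval p F = 0 := by
  have h : pointIdeal p ≤ RingHom.ker (eval p) := Ideal.span_le.mpr fun g hg => hg.2
  exact h hF

lemma MvPolynomial.IsHomogeneous.aeval_smul_eq {σ B : Type*} [CommRing B] [Algebra k B]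
    {F : MvPolynomial σ k} {t : ℕ} (hF : F.IsHomogeneous t) (r : B) (x : σ → B) :
    MvPolynomial.aeval (r • x) F = r ^ t * MvPolynomial.aeval x F := by
  rw [aeval_def, aeval_def, eval₂_eq, eval₂_eq, Finset.mul_sum]
  refine Finset.sum_congr rfl fun d hd => ?_
  have hdeg : ∑ i ∈ d.support, d i = t := (hF.degree_eq_sum_deg_support hd).symm
  simp only [Pi.smul_apply, smul_eq_mul, mul_pow, Finset.prod_mul_distrib,
    Finset.prod_pow_eq_pow_sum, hdeg]
  ring

lemma mem_pointIdeal_of_eval_eq_zero {p : Fin 3 → k} (hp : p ≠ 0)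
    {F : MvPolynomial (Fin 3) k} {t : ℕ} (hF : F.IsHomogeneous t) (h : eval p F = 0) :
    F ∈ pointIdeal p := by
  obtain ⟨i, hi⟩ := Function.ne_iff.mp hp
  let q := Ideal.Quotient.mkₐ k (pointIdeal p)
  have hq (x : MvPolynomial (Fin 3) k) : q x = 0 ↔ x ∈ pointIdeal p :=
    Ideal.Quotient.eq_zero_iff_mem
  have hlin : (fun j => algebraMap k _ (p i) * q (X j)) = q (X i) • (algebraMap k _ ∘ p) := by
    funext j
    have h0 : C (p i) * X j - C (p j) * X i ∈ pointIdeal p := by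
      refine Ideal.subset_span ⟨?_, by simp [mul_comm]⟩
      exact (isHomogeneous_C_mul_X _ _).sub (isHomogeneous_C_mul_X _ _)
    have h1 := (hq _).mpr h0
    rw [map_sub, map_mul, map_mul, ← algebraMap_eq, AlgHom.commutes, AlgHom.commutes,
      sub_eq_zero] at h1
    rw [h1, Pi.smul_apply, smul_eq_mul, mul_comm]
    rfl
  have h1 := hF.aeval_smul_eq (algebraMap k _ (p i)) (fun j => q (X j))
  have h2 := hF.aeval_smul_eq (q (X i)) (algebraMap k _ ∘ p)
  have h3 : MvPolynomial.aeval (fun j => q (X j)) F = q F := by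
    rw [← comp_aeval_apply, aeval_X_left_apply]
  have h4 : MvPolynomial.aeval (algebraMap k (MvPolynomial (Fin 3) k ⧸ pointIdeal p) ∘ p) F = 0 := by
    rw [aeval_algebraMap_apply, aeval_eq_eval, h, map_zero]
  have h5 : algebraMap k _ (p i) ^ t * q F = 0 := by
    rw [← h3, ← h1, ← mul_zero (q (X i) ^ t), ← h4, ← h2, ← hlin]
    rfl
  rw [← map_pow] at h5
  have hu : IsUnit (algebraMap k (MvPolynomial (Fin 3) k ⧸ pointIdeal p) (p i ^ t)) :=
    ((isUnit_iff_ne_zero.mpr hi).pow t).map _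
  exact (hq F).mp (hu.mul_right_eq_zero.mp h5)

instance (J : Ideal (MvPolynomial (Fin 3) k)) (t : ℕ) :
    FiniteDimensional k (gradedPiece J t) :=
  Submodule.finiteDimensional_of_le (inf_le_right : _ ≤ homogeneousSubmodule (Fin 3) k t)

/-- Linear syzygies of the forms of degree `s` in an ideal exist when there are few forms of
degree `s + 1`. -/
lemma exists_linearIndependent_linear_syzygies {J : Ideal (MvPolynomial (Fin 3) k)} {s : ℕ}
    (h : Module.finrank k (gradedPiece J (s + 1)) + 2 ≤ 3 * Module.finrank k (gradedPiece J s)) :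
    ∃ v v' : Fin 3 → MvPolynomial (Fin 3) k, LinearIndependent k ![v, v'] ∧
      (∀ i, v i ∈ gradedPiece J s) ∧ (∀ i, v' i ∈ gradedPiece J s) ∧
      v ⬝ᵥ X = 0 ∧ v' ⬝ᵥ X = 0 := by
  let ι : (Fin 3 → gradedPiece J s) →ₗ[k] (Fin 3 → MvPolynomial (Fin 3) k) :=
    LinearMap.pi fun i => (gradedPiece J s).subtype ∘ₗ LinearMap.proj i
  have hι : Function.Injective ι := fun w w' hw =>
    funext fun i => Subtype.ext (congrFun hw i)
  let T : (Fin 3 → gradedPiece J s) →ₗ[k] MvPolynomial (Fin 3) k :=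
    (Fintype.linearCombination (MvPolynomial (Fin 3) k) X).restrictScalars k ∘ₗ ι
  have hT (w) : T w = ι w ⬝ᵥ X := rfl
  have hrange : LinearMap.range T ≤ gradedPiece J (s + 1) := by
    rintro _ ⟨w, rfl⟩
    rw [hT]
    refine Submodule.sum_mem _ fun i _ => ⟨?_, ?_⟩
    · exact J.mul_mem_right _ (w i).2.1
    · exact IsHomogeneous.mul (w i).2.2 (isHomogeneous_X k i)
  have hrn := T.finrank_range_add_finrank_ker
  rw [Module.finrank_pi_fintype, Finset.sum_const, Finset.card_univ, Fintype.card_fin,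
    smul_eq_mul] at hrn
  have hker : 1 < Module.finrank k (LinearMap.ker T) := by
    have := Submodule.finrank_mono hrange
    omega
  have : Nontrivial (LinearMap.ker T) := Module.nontrivial_of_finrank_pos (R := k) (by omega)
  obtain ⟨x, hx⟩ := exists_ne (0 : LinearMap.ker T)
  obtain ⟨y, hxy⟩ := exists_linearIndependent_pair_of_one_lt_finrank (R := k)
    (M := LinearMap.ker T) hker (x := x) (by exact hx)
  refine ⟨ι x, ι y, ?_, fun i => (x.1 i).2, fun i => (y.1 i).2, x.2, y.2⟩
  have hinj : Function.Injective (ι ∘ₗ (LinearMap.ker T).subtype) := fun w w' hw =>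
    Subtype.ext (hι hw)
  have := hxy.map_injOn (ι ∘ₗ (LinearMap.ker T).subtype) hinj.injOn
  have hcomp : (ι ∘ₗ (LinearMap.ker T).subtype) ∘ ![x, y] = ![ι x, ι y] := by
    funext i
    fin_cases i <;> rfl
  rw [hcomp] at this
  exact this

end Points

end

/-- Let `I ⊂ k[x,y,z]` be the radical ideal of `n` distinct points of `ℙ²`
in tight generic `n`-position, `n = C(s+1,2) + h` with `s = indeg(I) ≥ 3` and
`0 ≤ h ≤ s/2 − 1`.  Then the rational map `ℙ² ⇢ ℙ^{s−h}` defined by a basis of the linear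
system `I_s` is birational onto its image. -/
theorem statement15 {k : Type*} [Field k] [IsAlgClosed k] {n s h : ℕ}
    (pts : Fin n → (Fin 3 → k)) (hfam : IsPointFamily pts)
    (htight : InTightGenericPosition pts s)
    (hindeg : HasInitialDegree (vanishingIdeal pts) s)
    (hs : 3 ≤ s) (hn : n = (s + 1).choose 2 + h) (hh : 2 * (h + 1) ≤ s)
    (f : Fin (s - h + 1) → MvPolynomial (Fin 3) k)
    (hfmem : ∀ i, f i ∈ gradedPiece (vanishingIdeal pts) s)
    (hfspan : Submodule.span k (Set.range f) = gradedPiece (vanishingIdeal pts) s) :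
    IsBirationalOntoImage f := by
  have h1 : (s + 1).choose 2 + (s + 1) = (s + 2).choose 2 := by
    rw [Nat.choose_succ_succ' (s + 1) 1, Nat.choose_one_right, add_comm]
  have h2 : (s + 2).choose 2 + (s + 2) = (s + 1 + 2).choose 2 := by
    rw [show s + 1 + 2 = s + 2 + 1 by ring, Nat.choose_succ_succ' (s + 2) 1,
      Nat.choose_one_right, add_comm]
  obtain ⟨v, v', hli, hv, hv', hvX, hvX'⟩ :=
    exists_linearIndependent_linear_syzygies (J := vanishingIdeal pts) (s := s) (by
      rw [htight.1, htight.1]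
      omega)
  have heval {F : MvPolynomial (Fin 3) k} (hF : F ∈ gradedPiece (vanishingIdeal pts) s) (p) :
      eval (pts p) F = 0 :=
    eval_eq_zero_of_mem_pointIdeal ((Submodule.mem_iInf _).mp hF.1 p)
  have hbot (F : MvPolynomial (Fin 3) k) (hF : F.IsHomogeneous (s - 1))
      (h0 : ∀ p, eval (pts p) F = 0) : F = 0 := by
    have hmem : F ∈ gradedPiece (vanishingIdeal pts) (s - 1) :=
      ⟨(Submodule.mem_iInf _).mpr fun p =>
        mem_pointIdeal_of_eval_eq_zero (hfam.1 p) hF (h0 p), hF⟩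
    rwa [hindeg.2 (s - 1) (by omega), Submodule.mem_bot] at hmem
  have hcross : v ⨯₃ v' ≠ 0 :=
    cross_ne_zero_of_linearIndependent (by omega) hbot (fun i => (hv i).2) (fun i => (hv' i).2)
      (fun p i => heval (hv i) p) (fun p i => heval (hv' i) p)
      (by rw [dotProduct_comm, hvX]) hli
  obtain ⟨w, hw⟩ := isPrimitiveFamily_X.exists_cross_eq_smul hvX hvX'
  have hform {F : MvPolynomial (Fin 3) k} (hF : F ∈ gradedPiece (vanishingIdeal pts) s) :
      ∃ L : MvPolynomial (Fin (s - h + 1)) k, L.IsHomogeneous 1 ∧ aeval f L = F := by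
    rw [← hfspan] at hF
    obtain ⟨c, rfl⟩ := (Submodule.mem_span_range_iff_exists_fun k).mp hF
    exact ⟨∑ j, C (c j) * X j,
      IsHomogeneous.sum _ _ _ fun j _ => isHomogeneous_C_mul_X _ _,
      by simp [smul_eq_C_mul]⟩
  choose L hL hLv using fun i => hform (hv i)
  choose L' hL' hLv' using fun i => hform (hv' i)
  refine ⟨1 + 1, L ⨯₃ L', w, ?_, isHomogeneous_cross hL hL', fun j => ?_⟩
  · rintro rfl
    exact hcross (by rw [hw, zero_smul])
  · have h3 : aeval f ((L ⨯₃ L') j) = (v ⨯₃ v') j := by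
      rw [cross_apply, cross_apply]
      fin_cases j <;> simp [← hLv, ← hLv']
    rw [h3, hw]
    rfl
end
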